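/- arXiv:1310.4123 — 2 statements merged into one kernel-verified Lean document; each statement's English description precedes it below -/
import Mathlib

section
/- A bounded mixed left identity yields a bounded left approximate identity. Let A be a Banach algebra over 𝕜 and suppose there exists ε ∈ A** such that ε(φ·a) = φ(a) for all a ∈ A and all φ ∈ A*. Then A possesses a bounded left approximate identity with bound ‖ε‖, i.e., a net (e_i)_{i∈I} in A with ‖e_i‖ ≤ ‖ε‖ for all i and lim_i ‖e_i a − a‖ = 0 for every a ∈ A. -/
open NormedSpace

/-- `A` possesses a left approximate identity bounded by `M`: a net `(e_i)` over
a nonempty directed index set with `‖e i‖ ≤ M` and `‖e i * a - a‖ → 0` for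
every `a`. -/
def HasBoundedLeftApproxId (A : Type) [NonUnitalNormedRing A] (M : ℝ) : Prop :=
  ∃ (I : Type) (pre : Preorder I),
    Nonempty I ∧ IsDirected I (fun s t => pre.le s t) ∧
    ∃ e : I → A, (∀ i : I, ‖e i‖ ≤ M) ∧
      ∀ a : A, Filter.Tendsto (fun i => ‖e i * a - a‖) (@Filter.atTop I pre) (nhds 0)

/-- If `re f ≤ u` on the closed ball of radius `M`, then `M * ‖f‖ ≤ u`. -/
theorem mul_opNorm_le_of_re_le {𝕜 E : Type*} [RCLike 𝕜] [NormedAddCommGroup E]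
    [NormedSpace 𝕜 E] (f : StrongDual 𝕜 E) {M u : ℝ} (hM : 0 ≤ M)
    (h : ∀ x, ‖x‖ ≤ M → RCLike.re (f x) ≤ u) : M * ‖f‖ ≤ u := by
  rcases hM.eq_or_lt with rfl | hM
  · simpa using h 0 (by simp)
  · rw [mul_comm, ← le_div_iff₀ hM]
    refine ContinuousLinearMap.opNorm_bound_of_ball_bound hM u f fun x hx ↦ ?_
    obtain ⟨c, hc, hcx⟩ := RCLike.exists_norm_eq_mul_self (f x)
    have := h (c • x) (by simpa [norm_smul, hc] using hx)
    rwa [map_smul, smul_eq_mul, ← hcx, RCLike.ofReal_re] at this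

/-- A Goldstine-type statement: if `ε` in the bidual satisfies `ε (f ∘ L) = f y` for every
functional `f`, then `y` is a limit of values of `L` on the ball of radius `‖ε‖`. -/
theorem mem_closure_image_closedBall_of_bidual {𝕜 E F : Type*} [RCLike 𝕜]
    [NormedAddCommGroup E] [NormedSpace 𝕜 E] [NormedAddCommGroup F] [NormedSpace 𝕜 F]
    (L : E →L[𝕜] F) (ε : StrongDual 𝕜 (StrongDual 𝕜 E)) (y : F)
    (h : ∀ f : StrongDual 𝕜 F, ε (f.comp L) = f y) :
    y ∈ closure (L '' Metric.closedBall 0 ‖ε‖) := by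
  let : NormedSpace ℝ E := NormedSpace.restrictScalars ℝ 𝕜 E
  let : NormedSpace ℝ F := NormedSpace.restrictScalars ℝ 𝕜 F
  have : IsScalarTower ℝ 𝕜 E := RestrictScalars.isScalarTower ℝ 𝕜 E
  have : IsScalarTower ℝ 𝕜 F := RestrictScalars.isScalarTower ℝ 𝕜 F
  by_contra hy
  have hconv : Convex ℝ (closure (L '' Metric.closedBall 0 ‖ε‖)) :=
    ((convex_closedBall 0 ‖ε‖).linear_image (L.restrictScalars ℝ).toLinearMap).closure
  obtain ⟨f, u, hu, huy⟩ :=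
    RCLike.geometric_hahn_banach_closed_point (𝕜 := 𝕜) hconv isClosed_closure hy
  have hle : ‖ε‖ * ‖f.comp L‖ ≤ u := mul_opNorm_le_of_re_le _ (norm_nonneg ε) fun x hx ↦
    (hu _ (subset_closure ⟨x, by simpa using hx, rfl⟩)).le
  have hge : RCLike.re (f y) ≤ ‖ε‖ * ‖f.comp L‖ := by
    rw [← h f]
    exact (RCLike.re_le_norm _).trans (ε.le_opNorm _)
  linarith

/-- **A bounded mixed left identity yields a bounded left approximate
identity**: if `ε ∈ A**` satisfies `ε(φ·a) = φ(a)` for all `a ∈ A`, `φ ∈ A*`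
(where `(φ·a)(x) = φ(x a)`), then `A` has a left approximate identity bounded
by `‖ε‖`. -/
theorem blai_of_mixed_identity
    (𝕜 : Type) [RCLike 𝕜] (A : Type)
    [NonUnitalNormedRing A] [NormedSpace 𝕜 A]
    [IsScalarTower 𝕜 A A] [SMulCommClass 𝕜 A A] [CompleteSpace A]
    (ε : StrongDual 𝕜 (StrongDual 𝕜 A))
    (hε : ∀ (a : A) (φ : StrongDual 𝕜 A),
      ε (φ.comp ((ContinuousLinearMap.mul 𝕜 A).flip a)) = φ a) :
    HasBoundedLeftApproxId A ‖ε‖ := by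
  classical
  have key (i : Finset A × ℕ) :
      ∃ e : A, ‖e‖ ≤ ‖ε‖ ∧ ∀ a ∈ i.1, ‖e * a - a‖ < 1 / ((i.2 : ℝ) + 1) := by
    obtain ⟨s, n⟩ := i
    let L : A →L[𝕜] (s → A) :=
      ContinuousLinearMap.pi fun a : s ↦ (ContinuousLinearMap.mul 𝕜 A).flip (a : A)
    have hL (f : StrongDual 𝕜 (s → A)) : ε (f.comp L) = f (fun a ↦ (a : A)) := by
      have hcomp : f.comp L = ∑ a : s, (f.comp (ContinuousLinearMap.single 𝕜 (fun _ ↦ A) a)).comp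
          ((ContinuousLinearMap.mul 𝕜 A).flip (a : A)) := by
        ext x
        simp only [sum_apply, ContinuousLinearMap.comp_apply, ← map_sum]
        congr 1
        exact (Finset.univ_sum_single (L x)).symm
      rw [hcomp, map_sum]
      simp only [hε, ContinuousLinearMap.comp_apply, ← map_sum]
      congr 1
      exact Finset.univ_sum_single _
    obtain ⟨_, ⟨e, he, rfl⟩, hdist⟩ := Metric.mem_closure_iff.1
      (mem_closure_image_closedBall_of_bidual L ε _ hL) (1 / ((n : ℝ) + 1)) (by positivity)
    refine ⟨e, by simpa using he, fun a ha ↦ ?_⟩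
    rw [← dist_eq_norm, dist_comm]
    exact (dist_le_pi_dist (fun a : s ↦ (a : A)) (L e) ⟨a, ha⟩).trans_lt hdist
  choose e he hea using key
  refine ⟨Finset A × ℕ, inferInstance, inferInstance, inferInstance, e, he, fun a ↦ ?_⟩
  have hlim : Filter.Tendsto (fun i : Finset A × ℕ ↦ 1 / ((i.2 : ℝ) + 1))
      Filter.atTop (nhds 0) := by
    refine tendsto_one_div_add_atTop_nhds_zero_nat.comp ?_
    rw [← Filter.prod_atTop_atTop_eq]
    exact Filter.tendsto_snd
  refine squeeze_zero' (.of_forall fun _ ↦ norm_nonneg _) ?_ hlim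
  filter_upwards [Filter.eventually_ge_atTop (({a}, 0) : Finset A × ℕ)] with i hi
  exact (hea i a (hi.1 (Finset.mem_singleton_self a))).le
end

section
/- Splitting of the dual extension for an ideal with bounded left approximate identity (the paper's Corollary on purity). Let B be a Banach algebra over 𝕜 (not necessarily unital) and let A be a closed right ideal of B possessing a bounded left approximate identity. Then the restriction map i* : B* → A*, the adjoint of the inclusion i : A → B, is surjective and admits a continuous linear right inverse λ : A* → B* with i* ∘ λ = id_{A*}; that is, the dual of the Banach-space extension 0 → A → B → B/A → 0 is split exact, so by the purity criterion this extension is pure. -/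
open NormedSpace

/-- A bounded family of scalars converges along every ultrafilter. -/
theorem exists_tendsto_ultrafilter_of_norm_le {𝕜 I : Type*} [RCLike 𝕜] (U : Ultrafilter I)
    {f : I → 𝕜} {C : ℝ} (hf : ∀ i, ‖f i‖ ≤ C) :
    ∃ c : 𝕜, Filter.Tendsto f U (nhds c) := by
  obtain ⟨c, -, hc⟩ := (isCompact_closedBall (0 : 𝕜) C).ultrafilter_le_nhds (U.map f)
    (Filter.tendsto_principal.2 (Filter.Eventually.of_forall fun i => by simpa using hf i))
  exact ⟨c, hc⟩

/-- **Splitting of the dual extension for a closed right ideal with a bounded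
left approximate identity.**  Here the Banach algebra `A` is realized as a
closed right ideal of the Banach algebra `B` by means of an isometric
multiplicative continuous linear embedding `j`; `m a b` is the element of `A`
carried by `j` to `j a * b` (the right-ideal property).  The conclusion asserts
that the restriction map `i* : B* → A*`, `ψ ↦ ψ ∘ j`, is surjective and admits
a continuous linear right inverse; i.e. the dual of the extension
`0 → A → B → B/A → 0` is split exact, hence this extension is pure. -/
theorem dual_extension_splits_of_blai
    (𝕜 : Type) [RCLike 𝕜]
    (A : Type) [NonUnitalNormedRing A] [NormedSpace 𝕜 A]
    [IsScalarTower 𝕜 A A] [SMulCommClass 𝕜 A A] [CompleteSpace A]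
    (B : Type) [NonUnitalNormedRing B] [NormedSpace 𝕜 B]
    [IsScalarTower 𝕜 B B] [SMulCommClass 𝕜 B B] [CompleteSpace B]
    (j : A →L[𝕜] B) (m : A → B → A)
    (hjmul : ∀ x y : A, j (x * y) = j x * j y)
    (hjiso : ∀ x : A, ‖j x‖ = ‖x‖)
    (hjideal : ∀ (x : A) (b : B), j (m x b) = j x * b)
    (hblai : ∃ M : ℝ, HasBoundedLeftApproxId A M) :
    Function.Surjective (fun ψ : StrongDual 𝕜 B => ψ.comp j) ∧
    ∃ lam : StrongDual 𝕜 A →L[𝕜] StrongDual 𝕜 B,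
      ∀ φ : StrongDual 𝕜 A, (lam φ).comp j = φ := by
  suffices h : ∃ lam : StrongDual 𝕜 A →L[𝕜] StrongDual 𝕜 B,
      ∀ φ : StrongDual 𝕜 A, (lam φ).comp j = φ by
    obtain ⟨lam, hlam⟩ := h
    exact ⟨fun φ => ⟨lam φ, hlam φ⟩, lam, hlam⟩
  obtain ⟨M, I, pre, hne, hdir, e, heM, he⟩ := hblai
  have hinj : Function.Injective j := fun x y hxy => by
    rw [← sub_eq_zero, ← norm_eq_zero, ← hjiso, map_sub, hxy, sub_self, norm_zero]
  have hadd (x : A) (b c : B) : m x (b + c) = m x b + m x c :=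
    hinj (by simp only [map_add, hjideal, mul_add])
  have hsmul (x : A) (r : 𝕜) (b : B) : m x (r • b) = r • m x b :=
    hinj (by simp only [map_smul, hjideal, mul_smul_comm])
  have hmul (x a : A) : m x (j a) = x * a := hinj (by rw [hjideal, hjmul])
  have hbound (φ : StrongDual 𝕜 A) (b : B) (i : I) : ‖φ (m (e i) b)‖ ≤ M * ‖φ‖ * ‖b‖ :=
    calc ‖φ (m (e i) b)‖ ≤ ‖φ‖ * ‖m (e i) b‖ := φ.le_opNorm _
      _ = ‖φ‖ * ‖j (e i) * b‖ := by rw [← hjiso, hjideal]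
      _ ≤ ‖φ‖ * (‖j (e i)‖ * ‖b‖) := by gcongr; exact norm_mul_le _ _
      _ ≤ ‖φ‖ * (M * ‖b‖) := by gcongr; rw [hjiso]; exact heM i
      _ = M * ‖φ‖ * ‖b‖ := by ring
  have : (Filter.atTop : Filter I).NeBot := Filter.atTop_neBot_iff.2 ⟨hne, hdir⟩
  let U : Ultrafilter I := Ultrafilter.of Filter.atTop
  have hU : (U : Filter I) ≤ Filter.atTop := Ultrafilter.of_le _
  choose L hL using fun (φ : StrongDual 𝕜 A) (b : B) =>
    exists_tendsto_ultrafilter_of_norm_le U (hbound φ b)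
  let T : StrongDual 𝕜 A →ₗ[𝕜] B →ₗ[𝕜] 𝕜 := LinearMap.mk₂ 𝕜 L
    (fun φ ψ b => tendsto_nhds_unique (hL (φ + ψ) b) ((hL φ b).add (hL ψ b)))
    (fun r φ b => tendsto_nhds_unique (hL (r • φ) b) ((hL φ b).const_smul r))
    (fun φ b c => tendsto_nhds_unique (hL φ (b + c))
      (((hL φ b).add (hL φ c)).congr fun i => by rw [hadd, map_add]))
    (fun r φ b => tendsto_nhds_unique (hL φ (r • b))
      (((hL φ b).const_smul r).congr fun i => by rw [hsmul, map_smul]))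
  refine ⟨T.mkContinuous₂ M fun φ b =>
    le_of_tendsto (hL φ b).norm (Filter.Eventually.of_forall (hbound φ b)), fun φ => ?_⟩
  ext a
  refine tendsto_nhds_unique (hL φ (j a)) ?_
  simp only [hmul]
  exact (φ.continuous.tendsto a).comp ((tendsto_iff_norm_sub_tendsto_zero.2 (he a)).mono_left hU)
end
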